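/- arXiv:1404.7165 — 4 statements merged into one kernel-verified Lean document; each statement's English description precedes it below -/
import Mathlib

section
/- The window intersection numbers determine the weights: for any natural numbers I₁, I₂, I₃ there is at most one tuple of natural numbers (x₁₁, x₂₂, x₃₃, x₁₂, x₁₃, x₂₃) satisfying Iᵢ = 2x_{ii} + x_{ij} + x_{ik} for each {i,j,k} = {1,2,3}, x_{ii}·x_{jk} = 0 for each {i,j,k} = {1,2,3}, and x_{ii}·x_{jj} = 0 for all i ≠ j. -/
/-- A self-weight is half the (truncated) excess of its window number over the other two. -/
theorem self_weight_eq_half_excess {I J K a b c p q r : ℕ}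
    (hI : I = 2 * a + p + q) (hJ : J = 2 * b + p + r) (hK : K = 2 * c + q + r)
    (har : a * r = 0) (hab : a * b = 0) (hac : a * c = 0) :
    a = (I - J - K) / 2 := by
  rw [Nat.mul_eq_zero] at har hab hac
  omega

/-- The window intersection numbers `I₁, I₂, I₃` determine the weights:
at most one tuple `(x₁₁, x₂₂, x₃₃, x₁₂, x₁₃, x₂₃)` of natural numbers satisfies
`Iᵢ = 2x_{ii} + x_{ij} + x_{ik}` together with the simplicity constraints
`x_{ii}·x_{jk} = 0` and `x_{ii}·x_{jj} = 0` (for `i ≠ j`). -/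
theorem stmt2 (I1 I2 I3 : ℕ)
    (x11 x22 x33 x12 x13 x23 : ℕ)
    (y11 y22 y33 y12 y13 y23 : ℕ)
    (hx1 : I1 = 2 * x11 + x12 + x13)
    (hx2 : I2 = 2 * x22 + x12 + x23)
    (hx3 : I3 = 2 * x33 + x13 + x23)
    (hxc1 : x11 * x23 = 0) (hxc2 : x22 * x13 = 0) (hxc3 : x33 * x12 = 0)
    (hxd1 : x11 * x22 = 0) (hxd2 : x11 * x33 = 0) (hxd3 : x22 * x33 = 0)
    (hy1 : I1 = 2 * y11 + y12 + y13)
    (hy2 : I2 = 2 * y22 + y12 + y23)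
    (hy3 : I3 = 2 * y33 + y13 + y23)
    (hyc1 : y11 * y23 = 0) (hyc2 : y22 * y13 = 0) (hyc3 : y33 * y12 = 0)
    (hyd1 : y11 * y22 = 0) (hyd2 : y11 * y33 = 0) (hyd3 : y22 * y33 = 0) :
    x11 = y11 ∧ x22 = y22 ∧ x33 = y33 ∧ x12 = y12 ∧ x13 = y13 ∧ x23 = y23 := by
  have hx11 := self_weight_eq_half_excess hx1 hx2 hx3 hxc1 hxd1 hxd2
  have hy11 := self_weight_eq_half_excess hy1 hy2 hy3 hyc1 hyd1 hyd2
  have hx22 : x22 = (I2 - I1 - I3) / 2 :=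
    self_weight_eq_half_excess hx2 hx1 (hx3.trans (add_right_comm ..)) hxc2
      ((mul_comm ..).trans hxd1) hxd3
  have hy22 : y22 = (I2 - I1 - I3) / 2 :=
    self_weight_eq_half_excess hy2 hy1 (hy3.trans (add_right_comm ..)) hyc2
      ((mul_comm ..).trans hyd1) hyd3
  have hx33 : x33 = (I3 - I1 - I2) / 2 :=
    self_weight_eq_half_excess hx3 (hx1.trans (add_right_comm ..)) (hx2.trans (add_right_comm ..))
      hxc3 ((mul_comm ..).trans hxd2) ((mul_comm ..).trans hxd3)
  have hy33 : y33 = (I3 - I1 - I2) / 2 :=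
    self_weight_eq_half_excess hy3 (hy1.trans (add_right_comm ..)) (hy2.trans (add_right_comm ..))
      hyc3 ((mul_comm ..).trans hyd2) ((mul_comm ..).trans hyd3)
  have h11 : x11 = y11 := hx11.trans hy11.symm
  have h22 : x22 = y22 := hx22.trans hy22.symm
  have h33 : x33 = y33 := hx33.trans hy33.symm
  omega
end

section
/- Let a = (1 2)(3 4)(5 6), b = (1 6)(2 3)(4 5) be permutations of {1,…,6}, let f_m be defined by f₀ = id, f_{m+1} = b ∘ f_m for m even, f_{m+1} = a ∘ f_m for m odd, and set σ_m = f_m ∘ a ∘ f_m⁻¹. If m ≡ 1 (mod 6) or m ≡ 3 (mod 6), then the subgroup of permutations of {1,…,6} generated by σ_m and a acts transitively on {1,…,6}; that is, the numerator closure N(SAT^m) has exactly one component and hence is a knot (this covers N(SAT^{6k−5}) and N(SAT^{6k−3}) for every positive integer k). -/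
/-- The involution `a = (1 2)(3 4)(5 6)` (labels `1,…,6` written as `0,…,5`). -/
def permA : Equiv.Perm (Fin 6) := Equiv.swap 0 1 * Equiv.swap 2 3 * Equiv.swap 4 5

/-- The involution `b = (1 6)(2 3)(4 5)` (labels `1,…,6` written as `0,…,5`). -/
def permB : Equiv.Perm (Fin 6) := Equiv.swap 0 5 * Equiv.swap 1 2 * Equiv.swap 3 4

/-- The connectivity permutation of `SAT^m`: `f₀ = id`, `f_{m+1} = b ∘ f_m` for
`m` even, and `f_{m+1} = a ∘ f_m` for `m` odd. -/
def connPerm : ℕ → Equiv.Perm (Fin 6)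
  | 0 => 1
  | m + 1 => if Even m then permB * connPerm m else permA * connPerm m

/-- The outer-endpoint matching involution `σ_m = f_m ∘ a ∘ f_m⁻¹` of `SAT^m`. -/
def sigmaPerm (m : ℕ) : Equiv.Perm (Fin 6) := connPerm m * permA * (connPerm m)⁻¹

theorem connPerm_periodic : Function.Periodic connPerm 6 := by
  intro m
  have hAB : permA * (permB * (permA * (permB * (permA * permB)))) = 1 := by decide
  have hBA : permB * (permA * (permB * (permA * (permB * permA)))) = 1 := by decide
  by_cases hm : Even m
  · simpa [connPerm, hm, Nat.even_add_one, mul_assoc] using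
      congrArg (· * connPerm m) hAB
  · simpa [connPerm, hm, Nat.even_add_one, mul_assoc] using
      congrArg (· * connPerm m) hBA

theorem sigmaPerm_mod_six (m : ℕ) : sigmaPerm (m % 6) = sigmaPerm m := by
  simp only [sigmaPerm, connPerm_periodic.map_mod_nat]

theorem sigmaPerm_one : sigmaPerm 1 = permA * permB * permA := by decide

set_option maxRecDepth 4000 in
theorem sigmaPerm_three : sigmaPerm 3 = permB := by decide

/-- The group generated by `permA` and `permB` is transitive on the six endpoints. -/
theorem exists_mem_apply_eq (H : Subgroup (Equiv.Perm (Fin 6))) (hA : permA ∈ H)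
    (hB : permB ∈ H) (x y : Fin 6) : ∃ g ∈ H, g x = y := by
  have words : ∀ x y : Fin 6, ∃ g ∈ [1, permA, permB, permA * permB, permB * permA,
      permA * permB * permA], g x = y := by decide
  obtain ⟨g, hg, hxy⟩ := words x y
  refine ⟨g, ?_, hxy⟩
  simp only [List.mem_cons, List.not_mem_nil, or_false] at hg
  rcases hg with rfl | rfl | rfl | rfl | rfl | rfl
  · exact H.one_mem
  · exact hA
  · exact hB
  · exact H.mul_mem hA hB
  · exact H.mul_mem hB hA
  · exact H.mul_mem (H.mul_mem hA hB) hA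

/-- Lemma 7.1 (knot cases for the numerator closure): if `m ≡ 1` or `m ≡ 3 (mod 6)`,
then the subgroup generated by `σ_m` and `a` acts transitively on the six endpoints,
so `N(SAT^m)` has exactly one component and is a knot. -/
theorem stmt8 (m : ℕ) (h : m % 6 = 1 ∨ m % 6 = 3) :
    ∀ x y : Fin 6, ∃ g ∈ Subgroup.closure {sigmaPerm m, permA}, g x = y := by
  have hA : permA ∈ Subgroup.closure {sigmaPerm m, permA} :=
    Subgroup.subset_closure (by simp)
  have hS : sigmaPerm m ∈ Subgroup.closure {sigmaPerm m, permA} :=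
    Subgroup.subset_closure (by simp)
  refine exists_mem_apply_eq _ hA ?_
  rcases h with h | h
  · have hB : permB = permA * sigmaPerm m * permA := by
      rw [← sigmaPerm_mod_six, h, sigmaPerm_one]
      decide
    have hmem := mul_mem (mul_mem hA hS) hA
    rwa [← hB] at hmem
  · have hB : sigmaPerm m = permB := by
      rw [← sigmaPerm_mod_six, h, sigmaPerm_three]
    exact hB ▸ hS
end

section
/- Let a = (1 2)(3 4)(5 6), b = (1 6)(2 3)(4 5) be permutations of {1,…,6}, let f_m be defined by f₀ = id, f_{m+1} = b ∘ f_m for m even, f_{m+1} = a ∘ f_m for m odd, and set σ_m = f_m ∘ a ∘ f_m⁻¹. If m ≡ 5 (mod 6), then the subgroup of permutations of {1,…,6} generated by σ_m and a has exactly three orbits on {1,…,6}; that is, the numerator closure N(SAT^m) = N(SAT^{6k−1}) is a link with three components for every positive integer k. -/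
theorem connPerm_add_six (m : ℕ) : connPerm (m + 6) = connPerm m := by
  have hab : permB * permA * permB * permA * permB * permA = 1 := by decide
  have hba : permA * permB * permA * permB * permA * permB = 1 := by decide
  by_cases hm : Even m
  · simp [connPerm, hm, Nat.even_add_one, ← mul_assoc, hba]
  · simp [connPerm, hm, Nat.even_add_one, ← mul_assoc, hab]

theorem connPerm_of_mod_six {m : ℕ} (h : m % 6 = 5) : connPerm m = permA := by
  have hper : Function.Periodic connPerm 6 := connPerm_add_six
  rw [← hper.map_mod_nat m, h]
  decide

theorem sigmaPerm_of_mod_six {m : ℕ} (h : m % 6 = 5) : sigmaPerm m = permA := by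
  simp [sigmaPerm, connPerm_of_mod_six h]

/-- The orbits of the group generated by an involution `g` are the sets `{x, g • x}`. -/
theorem orbitRel_closure_singleton_iff {G α : Type*} [Group G] [MulAction G α] {g : G}
    (hg : g ^ 2 = 1) (x y : α) :
    MulAction.orbitRel (Subgroup.closure {g}) α x y ↔ x = y ∨ x = g • y := by
  rw [MulAction.orbitRel_apply]
  constructor
  · rintro ⟨⟨k, hk⟩, rfl⟩
    obtain ⟨n, rfl⟩ := Subgroup.mem_closure_singleton.mp hk
    obtain ⟨j, rfl | rfl⟩ := n.even_or_odd'
    · left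
      simp [Subgroup.smul_def, zpow_mul, hg]
    · right
      simp [Subgroup.smul_def, zpow_add, zpow_mul, hg]
  · rintro (rfl | rfl)
    · exact MulAction.mem_orbit_self _
    · exact ⟨⟨g, Subgroup.subset_closure rfl⟩, rfl⟩

/-- The index of the pair among `{1,2}, {3,4}, {5,6}` containing a given endpoint. -/
def pairIndex (x : Fin 6) : Fin 3 := x.divNat (n := 2)

theorem pairIndex_surjective : Function.Surjective pairIndex := by decide

theorem orbitRel_closure_permA :
    MulAction.orbitRel (Subgroup.closure {permA}) (Fin 6) = Setoid.ker pairIndex := by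
  ext x y
  rw [orbitRel_closure_singleton_iff (by decide), Setoid.ker_def, Equiv.Perm.smul_def]
  revert x y
  decide

/-- Lemma 7.1 (three-component case for the numerator closure): if `m ≡ 5 (mod 6)`,
then the subgroup generated by `σ_m` and `a` has exactly three orbits on the six
endpoints, so `N(SAT^m)` is a link with three components. -/
theorem stmt9 (m : ℕ) (h : m % 6 = 5) :
    Nat.card
      (Quotient (MulAction.orbitRel
        ↥(Subgroup.closure {sigmaPerm m, permA}) (Fin 6))) = 3 := by
  rw [sigmaPerm_of_mod_six h, Set.pair_eq_singleton, orbitRel_closure_permA,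
    Nat.card_congr (Setoid.quotientKerEquivOfSurjective pairIndex pairIndex_surjective),
    Nat.card_fin]
end

section
/- Let a = (1 2)(3 4)(5 6), b = (1 6)(2 3)(4 5) be permutations of {1,…,6}, let f_m be defined by f₀ = id, f_{m+1} = b ∘ f_m for m even, f_{m+1} = a ∘ f_m for m odd, and set σ_m = f_m ∘ a ∘ f_m⁻¹. If m ≡ 0 (mod 6) or m ≡ 4 (mod 6), then the subgroup of permutations of {1,…,6} generated by σ_m and b acts transitively on {1,…,6}; that is, the denominator closure D(SAT^m) has exactly one component and hence is a knot (this covers D(SAT^{6k−6}) and D(SAT^{6k−2}) for every positive integer k). -/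
theorem connPerm_mod_six (m : ℕ) : connPerm (m % 6) = connPerm m :=
  Function.Periodic.map_mod_nat connPerm_add_six m

set_option maxRecDepth 10000 in
theorem exists_word_apply_eq (r : ℕ) (hr : r = 0 ∨ r = 4) (x y : Fin 6) :
    ∃ k : Fin 3, ∃ e : Fin 2,
      ((sigmaPerm r * permB) ^ (k : ℕ) * permB ^ (e : ℕ)) x = y := by
  revert x y
  rcases hr with rfl | rfl <;> decide

/-- Lemma 7.1 (knot cases for the denominator closure): if `m ≡ 0` or `m ≡ 4 (mod 6)`,
then the subgroup generated by `σ_m` and `b` acts transitively on the six endpoints,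
so `D(SAT^m)` has exactly one component and is a knot. -/
theorem stmt10 (m : ℕ) (h : m % 6 = 0 ∨ m % 6 = 4) :
    ∀ x y : Fin 6, ∃ g ∈ Subgroup.closure {sigmaPerm m, permB}, g x = y := by
  intro x y
  obtain ⟨k, e, hxy⟩ := exists_word_apply_eq (m % 6) h x y
  rw [sigmaPerm, connPerm_mod_six, ← sigmaPerm] at hxy
  have hσ : sigmaPerm m ∈ Subgroup.closure {sigmaPerm m, permB} :=
    Subgroup.subset_closure (by simp)
  have hB : permB ∈ Subgroup.closure {sigmaPerm m, permB} :=
    Subgroup.subset_closure (by simp)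
  exact ⟨_, mul_mem (pow_mem (mul_mem hσ hB) _) (pow_mem hB _), hxy⟩
end
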